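/- arXiv:2303.00547 — 2 statements merged into one kernel-verified Lean document; each statement's English description precedes it below -/
import Mathlib

section
/- Let κ be a regular infinite cardinal and let T be a pruned order tree. Then every open cover of the ray space R(T) has a subcover of cardinality < κ if and only if every node of T has fewer than κ successors. -/
open Set Topology

universe u v

/-- An order tree: a partial order with a minimum element (the root) in which
the set of predecessors of every element is a well-ordered chain. -/
def IsOrderTree (T : Type u) [PartialOrder T] : Prop :=
  (∃ r : T, ∀ t : T, r ≤ t) ∧
    ∀ t : T, IsChain (· ≤ ·) (Set.Iic t) ∧ (Set.Iic t).IsWF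

/-- A tree is special if it is the union of countably many antichains. -/
def IsSpecialTree (T : Type u) [PartialOrder T] : Prop :=
  ∃ A : ℕ → Set T, (∀ n, IsAntichain (· ≤ ·) (A n)) ∧ (⋃ n, A n) = Set.univ

/-- A path of `T`: a down-closed chain. -/
def IsPath {T : Type u} [PartialOrder T] (x : Set T) : Prop :=
  IsChain (· ≤ ·) x ∧ ∀ ⦃s t : T⦄, s ≤ t → t ∈ x → s ∈ x

/-- A ray: a path with no maximal element. -/
def IsRay {T : Type u} [PartialOrder T] (x : Set T) : Prop :=
  IsPath x ∧ ∀ t ∈ x, ∃ s ∈ x, t < s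

/-- A branch: an inclusion-wise maximal path. -/
def IsBranch {T : Type u} [PartialOrder T] (x : Set T) : Prop :=
  IsPath x ∧ ∀ y : Set T, IsPath y → x ⊆ y → y = x

/-- The product topology of `2^T`, transported to `Set T` via characteristic
functions: it is generated by the sets `{s | t ∈ s}` and their complements. -/
def cylinderTopology (T : Type u) : TopologicalSpace (Set T) :=
  TopologicalSpace.generateFrom
    {C : Set (Set T) | ∃ t : T, C = {s : Set T | t ∈ s} ∨ C = {s : Set T | t ∉ s}}

/-- The path space `P(T)`. -/
def PathSpace (T : Type u) [PartialOrder T] : Type u := {x : Set T // IsPath x}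

/-- The ray space `R(T)`. -/
def RaySpace (T : Type u) [PartialOrder T] : Type u := {x : Set T // IsRay x}

/-- The branch space `B(T)`. -/
def BranchSpace (T : Type u) [PartialOrder T] : Type u := {x : Set T // IsBranch x}

instance PathSpace.topologicalSpace (T : Type u) [PartialOrder T] :
    TopologicalSpace (PathSpace T) :=
  TopologicalSpace.induced (fun x => x.1) (cylinderTopology T)

instance RaySpace.topologicalSpace (T : Type u) [PartialOrder T] :
    TopologicalSpace (RaySpace T) :=
  TopologicalSpace.induced (fun x => x.1) (cylinderTopology T)

instance BranchSpace.topologicalSpace (T : Type u) [PartialOrder T] :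
    TopologicalSpace (BranchSpace T) :=
  TopologicalSpace.induced (fun x => x.1) (cylinderTopology T)

/-- The subbasic set `[t] = {x ∈ R(T) : t ∈ x}`. -/
def raySet {T : Type u} [PartialOrder T] (t : T) : Set (RaySpace T) := {x | t ∈ x.1}

/-- The basic set `[t] = {x ∈ B(T) : t ∈ x}`. -/
def branchSet {T : Type u} [PartialOrder T] (t : T) : Set (BranchSpace T) := {x | t ∈ x.1}

/-- A top of a ray `x` is a node whose set of strict predecessors is exactly `x`. -/
def IsTopOf {T : Type u} [PartialOrder T] (t : T) (x : Set T) : Prop := Set.Iio t = x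

/-- `s` is a successor of `t`. -/
def IsSuccessorOf {T : Type u} [PartialOrder T] (s t : T) : Prop :=
  t < s ∧ ∀ u : T, t < u → u < s → False

/-- A tree is pruned if every node has a successor. -/
def IsPruned (T : Type u) [PartialOrder T] : Prop := ∀ t : T, ∃ s : T, IsSuccessorOf s t

/-- A family of sets is nested if any two intersecting members are ⊆-comparable. -/
def NestedFam {X : Type v} (𝒜 : Set (Set X)) : Prop :=
  ∀ A ∈ 𝒜, ∀ B ∈ 𝒜, (A ∩ B).Nonempty → A ⊆ B ∨ B ⊆ A

/-- A family of sets is noetherian if every ⊆-increasing sequence of its members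
is eventually constant. -/
def NoetherianFam {X : Type v} (𝒜 : Set (Set X)) : Prop :=
  ∀ f : ℕ → Set X, (∀ n, f n ∈ 𝒜) → Monotone f → ∃ N, ∀ n, N ≤ n → f n = f N

/-- A family of sets is centered if every finite subfamily has nonempty intersection. -/
def CenteredFam {X : Type v} (𝒜 : Set (Set X)) : Prop :=
  ∀ F : Finset (Set X), ↑F ⊆ 𝒜 → (⋂₀ (F : Set (Set X))).Nonempty

/-- A family of sets is complete if every centered subfamily has nonempty intersection. -/
def CompleteFam {X : Type v} (𝒜 : Set (Set X)) : Prop :=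
  ∀ 𝒞 ⊆ 𝒜, CenteredFam 𝒞 → (⋂₀ 𝒞).Nonempty

/-- A family is hereditarily complete if its trace on every closed set is complete. -/
def HeredCompleteFam {X : Type v} [TopologicalSpace X] (𝒜 : Set (Set X)) : Prop :=
  ∀ Y : Set X, IsClosed Y → CompleteFam {B : Set X | ∃ A ∈ 𝒜, B = A ∩ Y}

/-- A family is σ-disjoint if it is a countable union of pairwise disjoint subfamilies. -/
def SigmaDisjointFam {X : Type v} (𝒜 : Set (Set X)) : Prop :=
  ∃ D : ℕ → Set (Set X), (∀ n, (D n).Pairwise Disjoint) ∧ (⋃ n, D n) = 𝒜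

/-- `S` is a clopen subbase for `X` if the topology of `X` is the coarsest one in which
every member of `S` is clopen, i.e. it is generated by `S` together with the complements
of members of `S`. -/
def IsClopenSubbase {X : Type v} [t : TopologicalSpace X] (S : Set (Set X)) : Prop :=
  t = TopologicalSpace.generateFrom (S ∪ {B : Set X | ∃ A ∈ S, B = Aᶜ})

/-- `B` is a base for the topology of `X`. -/
def IsBaseFam {X : Type v} [TopologicalSpace X] (B : Set (Set X)) : Prop :=
  (∀ U ∈ B, IsOpen U) ∧ ∀ U : Set X, IsOpen U → ∀ x ∈ U, ∃ V ∈ B, x ∈ V ∧ V ⊆ U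
theorem exists_finite_basic_of_isOpen {T : Type u} {V : Set (Set T)}
    (hV : IsOpen[cylinderTopology T] V) :
    ∀ x ∈ V, ∃ G F : Set T, G.Finite ∧ F.Finite ∧ G ⊆ x ∧ Disjoint F x ∧
      ∀ y : Set T, G ⊆ y → Disjoint F y → y ∈ V := by
  induction hV with
  | basic C hC =>
    intro x hx
    obtain ⟨t, rfl | rfl⟩ := hC
    · exact ⟨{t}, ∅, finite_singleton t, finite_empty, by simpa using hx, by simp,
        fun y hy _ => hy rfl⟩
    · exact ⟨∅, {t}, finite_empty, finite_singleton t, by simp, by simpa using hx,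
        fun y _ hy => by simpa using hy⟩
  | univ => exact fun x _ => ⟨∅, ∅, by simp⟩
  | inter A B _ _ ihA ihB =>
    intro x hx
    obtain ⟨G, F, hG, hF, hGx, hFx, h⟩ := ihA x hx.1
    obtain ⟨G', F', hG', hF', hGx', hFx', h'⟩ := ihB x hx.2
    refine ⟨G ∪ G', F ∪ F', hG.union hG', hF.union hF', union_subset hGx hGx',
      disjoint_union_left.2 ⟨hFx, hFx'⟩, fun y hy hFy => ?_⟩
    rw [disjoint_union_left] at hFy
    exact ⟨h y (subset_union_left.trans hy) hFy.1, h' y (subset_union_right.trans hy) hFy.2⟩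
  | sUnion 𝒮 _ ih =>
    rintro x ⟨A, hA, hxA⟩
    obtain ⟨G, F, hG, hF, hGx, hFx, h⟩ := ih A hA x hxA
    exact ⟨G, F, hG, hF, hGx, hFx, fun y hy hFy => ⟨A, hA, h y hy hFy⟩⟩

theorem isOpen_raySet {T : Type u} [PartialOrder T] (t : T) : IsOpen (raySet t) :=
  ⟨{s | t ∈ s}, TopologicalSpace.GenerateOpen.basic _ ⟨t, Or.inl rfl⟩, rfl⟩

theorem isOpen_compl_raySet {T : Type u} [PartialOrder T] (t : T) :
    IsOpen (raySet t)ᶜ :=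
  ⟨{s | t ∉ s}, TopologicalSpace.GenerateOpen.basic _ ⟨t, Or.inr rfl⟩, rfl⟩

theorem raySet_anti {T : Type u} [PartialOrder T] {s t : T} (h : s ≤ t) :
    raySet t ⊆ raySet s :=
  fun x hx => x.2.1.2 h hx

theorem raySet_nonempty {T : Type u} [PartialOrder T] (hT : IsOrderTree T) (hp : IsPruned T)
    (t : T) : (raySet t).Nonempty := by
  choose f hf using hp
  let g : ℕ → T := fun n => f^[n] t
  have hg : StrictMono g := strictMono_nat_of_lt_succ fun n => by
    simp only [g, Function.iterate_succ_apply']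
    exact (hf _).1
  refine ⟨⟨{s | ∃ n, s ≤ g n}, ⟨?_, ?_⟩, ?_⟩, 0, le_rfl⟩
  · rintro a ⟨n, hn⟩ b ⟨m, hm⟩ hab
    exact (hT.2 (g (max n m))).1 (hn.trans (hg.monotone (le_max_left n m)))
      (hm.trans (hg.monotone (le_max_right n m))) hab
  · rintro a b hab ⟨n, hn⟩
    exact ⟨n, hab.trans hn⟩
  · rintro a ⟨n, hn⟩
    exact ⟨g (n + 1), ⟨n + 1, le_rfl⟩, hn.trans_lt (hg n.lt_succ_self)⟩

theorem exists_successor_le {T : Type u} [PartialOrder T] (hT : IsOrderTree T) {t u : T}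
    (h : t < u) : ∃ s, IsSuccessorOf s t ∧ s ≤ u := by
  have hwf : (Iic u ∩ Ioi t).IsWF := (hT.2 u).2.mono inter_subset_left
  have hne : (Iic u ∩ Ioi t).Nonempty := ⟨u, le_rfl, h⟩
  have hmem := hwf.min_mem hne
  exact ⟨hwf.min hne, ⟨hmem.2, fun v htv hv =>
    hwf.not_lt_min hne ⟨hv.le.trans hmem.1, htv⟩ hv⟩, hmem.1⟩

theorem IsSuccessorOf.eq_of_mem {T : Type u} [PartialOrder T] {s s' t : T} {x : Set T}
    (hx : IsPath x) (hs : IsSuccessorOf s t) (hs' : IsSuccessorOf s' t)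
    (hsx : s ∈ x) (hsx' : s' ∈ x) : s = s' := by
  by_contra hne
  rcases hx.1 hsx hsx' hne with h | h
  · exact hs'.2 s hs.1 (h.lt_of_ne hne)
  · exact hs.2 s' hs'.1 (h.lt_of_ne' hne)

theorem isPath_Iic {T : Type u} [PartialOrder T] (hT : IsOrderTree T) (t : T) :
    IsPath (Iic t) :=
  ⟨(hT.2 t).1, fun _ _ hab hb => hab.trans hb⟩

/-- Every finite subset of a nonempty chain is bounded above by an element of the chain. -/
theorem exists_upperBound_mem_of_finite {T : Type u} [PartialOrder T] {x K : Set T}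
    (hx : IsChain (· ≤ ·) x) (hne : x.Nonempty) (hK : K.Finite) (hKx : K ⊆ x) :
    ∃ t ∈ x, ∀ k ∈ K, k ≤ t := by
  induction K, hK using Set.Finite.induction_on with
  | empty => exact ⟨hne.some, hne.some_mem, by simp⟩
  | insert _ _ ih =>
    rw [insert_subset_iff] at hKx
    obtain ⟨t, ht, h⟩ := ih hKx.2
    rcases hx.total hKx.1 ht with hat | hta
    · exact ⟨t, ht, forall_mem_insert.2 ⟨hat, h⟩⟩
    · exact ⟨_, hKx.1, forall_mem_insert.2 ⟨le_rfl, fun k hk => (h k hk).trans hta⟩⟩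

/-- `A` is covered by fewer than `κ` members of `𝒰`. -/
def CoveredByLT {X : Type u} (κ : Cardinal.{u}) (𝒰 : Set (Set X)) (A : Set X) : Prop :=
  ∃ 𝒱 ⊆ 𝒰, A ⊆ ⋃₀ 𝒱 ∧ Cardinal.mk ↥𝒱 < κ

namespace CoveredByLT

variable {X : Type u} {κ : Cardinal.{u}} {𝒰 : Set (Set X)} {A B : Set X}

theorem mono (hB : CoveredByLT κ 𝒰 B) (h : A ⊆ B) : CoveredByLT κ 𝒰 A :=
  let ⟨𝒱, h𝒱, hB𝒱, hc⟩ := hB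
  ⟨𝒱, h𝒱, h.trans hB𝒱, hc⟩

theorem of_mem (hκ : κ.IsRegular) (h : A ∈ 𝒰) : CoveredByLT κ 𝒰 A :=
  ⟨{A}, by simpa using h, by simp, by
    simpa using Cardinal.one_lt_aleph0.trans_le hκ.aleph0_le⟩

theorem biUnion (hκ : κ.IsRegular) {ι : Type u} {S : Set ι} (hS : Cardinal.mk S < κ)
    {f : ι → Set X} (hf : ∀ i ∈ S, CoveredByLT κ 𝒰 (f i)) :
    CoveredByLT κ 𝒰 (⋃ i ∈ S, f i) := by
  choose! 𝒱 h𝒱 hf𝒱 hc using hf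
  refine ⟨⋃ i ∈ S, 𝒱 i, iUnion₂_subset h𝒱, iUnion₂_subset fun i hi => ?_, ?_⟩
  · exact (hf𝒱 i hi).trans (sUnion_subset_sUnion (subset_biUnion_of_mem hi))
  · exact (Cardinal.card_biUnion_lt_iff_forall_of_isRegular hκ hS).2 hc

theorem union (hκ : κ.IsRegular) (hA : CoveredByLT κ 𝒰 A) (hB : CoveredByLT κ 𝒰 B) :
    CoveredByLT κ 𝒰 (A ∪ B) := by
  obtain ⟨𝒱, h𝒱, hA, hc⟩ := hA
  obtain ⟨𝒲, h𝒲, hB, hd⟩ := hB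
  refine ⟨𝒱 ∪ 𝒲, union_subset h𝒱 h𝒲, ?_, ?_⟩
  · rw [sUnion_union]
    exact union_subset_union hA hB
  · exact (Cardinal.mk_union_le 𝒱 𝒲).trans_lt (Cardinal.add_lt_of_lt hκ.aleph0_le hc hd)

end CoveredByLT

theorem mk_successors_lt_of_forall_subcover {T : Type u} [PartialOrder T] (hT : IsOrderTree T)
    (hp : IsPruned T) {κ : Cardinal.{u}}
    (h : ∀ 𝒰 : Set (Set (RaySpace T)), (∀ U ∈ 𝒰, IsOpen U) → ⋃₀ 𝒰 = Set.univ →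
      ∃ 𝒱 ⊆ 𝒰, ⋃₀ 𝒱 = Set.univ ∧ Cardinal.mk ↥𝒱 < κ) (t : T) :
    Cardinal.mk ↥{s : T | IsSuccessorOf s t} < κ := by
  obtain ⟨𝒱, h𝒱, hcov, hc⟩ := h (insert (raySet t)ᶜ (raySet '' {s | IsSuccessorOf s t}))
    (by
      rintro U (rfl | ⟨s, -, rfl⟩)
      · exact isOpen_compl_raySet t
      · exact isOpen_raySet s)
    (by
      refine eq_univ_of_forall fun x => ?_
      by_cases hx : x ∈ raySet t
      · obtain ⟨u, hu, htu⟩ := x.2.2 t hx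
        obtain ⟨s, hs, hsu⟩ := exists_successor_le hT htu
        exact ⟨raySet s, Or.inr ⟨s, hs, rfl⟩, x.2.1.2 hsu hu⟩
      · exact ⟨_, Or.inl rfl, hx⟩)
  have hmem : ∀ s : {s : T | IsSuccessorOf s t}, raySet s.1 ∈ 𝒱 := by
    rintro ⟨s, hs⟩
    obtain ⟨x, hx⟩ := raySet_nonempty hT hp s
    obtain ⟨U, hU, hxU⟩ := hcov.symm.subset (mem_univ x)
    obtain rfl | ⟨s', hs', rfl⟩ := h𝒱 hU
    · exact absurd (raySet_anti hs.1.le hx) hxU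
    · obtain rfl : s = s' := hs.eq_of_mem x.2.1 hs' hx hxU
      exact hU
  refine (Cardinal.mk_le_of_injective (f := fun s => (⟨_, hmem s⟩ : 𝒱)) ?_).trans_lt hc
  rintro ⟨s, hs⟩ ⟨s', hs'⟩ heq
  obtain ⟨x, hx⟩ := raySet_nonempty hT hp s
  have heq : raySet s = raySet s' := congrArg Subtype.val heq
  exact Subtype.ext (hs.eq_of_mem x.2.1 hs' hx (heq ▸ hx : x ∈ raySet s'))

/-- A node whose ray set is not covered by few members of `𝒰` has a successor with the
same property. -/
theorem exists_successor_not_coveredByLT {T : Type u} [PartialOrder T] (hT : IsOrderTree T)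
    {κ : Cardinal.{u}} (hκ : κ.IsRegular) {𝒰 : Set (Set (RaySpace T))} {t : T}
    (hsucc : Cardinal.mk ↥{s : T | IsSuccessorOf s t} < κ)
    (ht : ¬ CoveredByLT κ 𝒰 (raySet t)) :
    ∃ s, t < s ∧ ¬ CoveredByLT κ 𝒰 (raySet s) := by
  by_contra! hcon
  refine ht ((CoveredByLT.biUnion hκ hsucc fun s hs => hcon s hs.1).mono fun x hx => ?_)
  obtain ⟨u, hu, htu⟩ := x.2.2 t hx
  obtain ⟨s, hs, hsu⟩ := exists_successor_le hT htu
  exact mem_biUnion hs (x.2.1.2 hsu hu)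

/-- If no node of a ray has a ray set covered by few members of an open cover `𝒰`, then some
node above the whole ray has the same property. -/
theorem exists_above_ray_not_coveredByLT {T : Type u} [PartialOrder T]
    {κ : Cardinal.{u}} (hκ : κ.IsRegular) {𝒰 : Set (Set (RaySpace T))}
    (hopen : ∀ U ∈ 𝒰, IsOpen U) (hcov : ⋃₀ 𝒰 = Set.univ)
    (huniv : ¬ CoveredByLT κ 𝒰 univ) (x : RaySpace T)
    (hx : ∀ t ∈ x.1, ¬ CoveredByLT κ 𝒰 (raySet t)) :
    ∃ s, (∀ t ∈ x.1, t < s) ∧ ¬ CoveredByLT κ 𝒰 (raySet s) := by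
  by_contra! hcon
  have hfin : ∀ K : Set T, K.Finite → K ⊆ x.1 →
      ¬ CoveredByLT κ 𝒰 {y : RaySpace T | K ⊆ y.1} := by
    intro K hK hKx hcK
    rcases x.1.eq_empty_or_nonempty with he | hne
    · obtain rfl : K = ∅ := subset_eq_empty hKx he
      exact huniv (hcK.mono fun y _ => empty_subset y.1)
    · obtain ⟨t, ht, hKt⟩ := exists_upperBound_mem_of_finite x.2.1.1 hne hK hKx
      exact hx t ht (hcK.mono fun y hy k hk => y.2.1.2 (hKt k hk) hy)
  obtain ⟨U, hU, hxU⟩ := hcov.symm.subset (mem_univ x)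
  obtain ⟨V, hV, rfl⟩ := hopen U hU
  obtain ⟨G, F, hG, hF, hGx, hFx, hGF⟩ := exists_finite_basic_of_isOpen hV x.1 hxU
  have hbad : ∀ s, ∃ t, ¬ CoveredByLT κ 𝒰 (raySet s) → t ∈ x.1 ∧ ¬ t < s := by
    intro s
    by_cases hs : CoveredByLT κ 𝒰 (raySet s)
    · exact ⟨s, fun h => absurd hs h⟩
    · have : ¬ ∀ t ∈ x.1, t < s := fun h => hs (hcon s h)
      push Not at this
      obtain ⟨t, ht⟩ := this
      exact ⟨t, fun _ => ht⟩
  choose b hb using hbad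
  let F' : Set T := {s ∈ F | ¬ CoveredByLT κ 𝒰 (raySet s)}
  let F₀ : Set T := {s ∈ F | CoveredByLT κ 𝒰 (raySet s)}
  have hF₀ : Cardinal.mk F₀ < κ :=
    (hF.subset (sep_subset _ _)).lt_aleph0.trans_le hκ.aleph0_le
  refine hfin (G ∪ b '' F') (hG.union ((hF.subset (sep_subset _ _)).image b))
    (union_subset hGx ?_) (((CoveredByLT.of_mem hκ hU).union hκ
      (CoveredByLT.biUnion hκ hF₀ (f := raySet) fun s hs => hs.2)).mono fun y hy => ?_)
  · rintro _ ⟨s, hs, rfl⟩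
    exact (hb s hs.2).1
  · by_cases hFy : Disjoint F y.1
    · exact Or.inl (hGF y.1 (subset_union_left.trans hy) hFy)
    · obtain ⟨s, hsF, hsy⟩ := not_disjoint_iff.1 hFy
      by_cases hs : CoveredByLT κ 𝒰 (raySet s)
      · exact Or.inr (mem_biUnion (show s ∈ F₀ from ⟨hsF, hs⟩) hsy)
      · obtain ⟨hbx, hbs⟩ := hb s hs
        have hsx : s ∉ x.1 := disjoint_left.1 hFx hsF
        have hby : b s ∈ y.1 := hy (Or.inr ⟨s, ⟨hsF, hs⟩, rfl⟩)
        rcases y.2.1.1.total hby hsy with h | h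
        · exact absurd (h.lt_of_ne fun h' => hsx (h' ▸ hbx)) hbs
        · exact absurd (x.2.1.2 h hbx) hsx

theorem coveredByLT_univ {T : Type u} [PartialOrder T] (hT : IsOrderTree T)
    {κ : Cardinal.{u}} (hκ : κ.IsRegular)
    (hsucc : ∀ t : T, Cardinal.mk ↥{s : T | IsSuccessorOf s t} < κ)
    {𝒰 : Set (Set (RaySpace T))} (hopen : ∀ U ∈ 𝒰, IsOpen U) (hcov : ⋃₀ 𝒰 = Set.univ) :
    CoveredByLT κ 𝒰 univ := by
  by_contra huniv
  obtain ⟨m, ⟨hm, hmc⟩, hmax⟩ := zorn_subset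
    {p : Set T | IsPath p ∧ ∀ t ∈ p, ¬ CoveredByLT κ 𝒰 (raySet t)} (by
      refine fun c hc hchain => ⟨⋃₀ c, ⟨⟨?_, ?_⟩, ?_⟩, fun s => subset_sUnion_of_mem⟩
      · rintro a ⟨p, hp, ha⟩ b ⟨q, hq, hb⟩ hab
        rcases hchain.total hp hq with h | h
        · exact (hc hq).1.1 (h ha) hb hab
        · exact (hc hp).1.1 ha (h hb) hab
      · rintro a b hab ⟨p, hp, hb⟩
        exact ⟨p, hp, (hc hp).1.2 hab hb⟩
      · rintro t ⟨p, hp, ht⟩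
        exact (hc hp).2 t ht)
  have key : ∃ s, (∀ t ∈ m, t < s) ∧ ¬ CoveredByLT κ 𝒰 (raySet s) := by
    by_cases hray : IsRay m
    · exact exists_above_ray_not_coveredByLT hκ hopen hcov huniv ⟨m, hray⟩ hmc
    · have : ¬ ∀ t ∈ m, ∃ s ∈ m, t < s := fun h => hray ⟨hm, h⟩
      push Not at this
      obtain ⟨t, ht, htm⟩ := this
      obtain ⟨s, hts, hs⟩ := exists_successor_not_coveredByLT hT hκ (hsucc t) (hmc t ht)
      refine ⟨s, fun u hu => lt_of_le_of_lt ?_ hts, hs⟩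
      rcases hm.1.total hu ht with h | h
      · exact h
      · exact (eq_of_le_of_not_lt h (htm u hu)).ge
  obtain ⟨s, hms, hs⟩ := key
  have hsm : s ∈ m := hmax ⟨isPath_Iic hT s, fun t ht h => hs (h.mono (raySet_anti ht))⟩
    (fun t ht => (hms t ht).le) le_rfl
  exact (hms s hsm).false

/-- For a regular infinite cardinal `κ` and a pruned order tree `T`, every
open cover of `R(T)` has a subcover of cardinality `< κ` iff every node of `T` has
fewer than `κ` successors. -/
theorem stmt7 {T : Type u} [PartialOrder T] (hT : IsOrderTree T) (hp : IsPruned T)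
    (κ : Cardinal.{u}) (hκ : κ.IsRegular) :
    (∀ 𝒰 : Set (Set (RaySpace T)), (∀ U ∈ 𝒰, IsOpen U) → ⋃₀ 𝒰 = Set.univ →
      ∃ 𝒱 ⊆ 𝒰, ⋃₀ 𝒱 = Set.univ ∧ Cardinal.mk ↥𝒱 < κ) ↔
    ∀ t : T, Cardinal.mk ↥{s : T | IsSuccessorOf s t} < κ := by
  refine ⟨mk_successors_lt_of_forall_subcover hT hp, fun hsucc 𝒰 hopen hcov => ?_⟩
  obtain ⟨𝒱, h𝒱, hsub, hc⟩ := coveredByLT_univ hT hκ hsucc hopen hcov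
  exact ⟨𝒱, h𝒱, univ_subset_iff.1 hsub, hc⟩
end

section
/- Let T be an order tree with no uncountable branches (i.e., every branch of T is countable). Then the set of points of R(T) at which the ray space R(T) is first countable (has a countable neighbourhood base) is dense in R(T). -/
open Set Topology

universe u v

open Filter in
/-- Neighbourhoods in the ray space are generated by the subbasic cylinder sets. -/
theorem RaySpace.nhds_eq {T : Type u} [PartialOrder T] (x : RaySpace T) :
    𝓝 x = (⨅ t : x.1, 𝓟 (raySet t.1)) ⊓ ⨅ t : (x.1ᶜ : Set T), 𝓟 (raySet t.1)ᶜ := by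
  have htop : RaySpace.topologicalSpace T = _ := induced_generateFrom_eq
  rw [htop, TopologicalSpace.nhds_generateFrom]
  apply le_antisymm
  · refine le_inf (le_iInf fun t => ?_) (le_iInf fun t => ?_)
    · exact iInf₂_le _ ⟨t.2, {s : Set T | t.1 ∈ s}, ⟨t, Or.inl rfl⟩, rfl⟩
    · exact iInf₂_le _ ⟨t.2, {s : Set T | t.1 ∉ s}, ⟨t, Or.inr rfl⟩, rfl⟩
  · refine le_iInf₂ ?_
    rintro _ ⟨hx, _, ⟨t, rfl | rfl⟩, rfl⟩
    · exact inf_le_left.trans (iInf_le _ (⟨t, hx⟩ : x.1))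
    · exact inf_le_right.trans (iInf_le _ (⟨t, hx⟩ : (x.1ᶜ : Set T)))

/-- A neighbourhood of a ray `x` contains all rays that extend `x` and avoid some finite set
of nodes outside `x`. -/
theorem RaySpace.exists_finite_of_mem_nhds {T : Type u} [PartialOrder T] {x : RaySpace T}
    {U : Set (RaySpace T)} (hU : U ∈ 𝓝 x) :
    ∃ F : Set T, F.Finite ∧ Disjoint F x.1 ∧
      ∀ y : RaySpace T, x.1 ⊆ y.1 → Disjoint F y.1 → y ∈ U := by
  obtain ⟨V, hVU, hV, hxV⟩ := mem_nhds_iff.1 hU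
  have htop : RaySpace.topologicalSpace T = _ := induced_generateFrom_eq
  rw [htop] at hV
  suffices h : ∃ F : Set T, F.Finite ∧ Disjoint F x.1 ∧
      ∀ y : RaySpace T, x.1 ⊆ y.1 → Disjoint F y.1 → y ∈ V by
    obtain ⟨F, hF, hFx, h⟩ := h
    exact ⟨F, hF, hFx, fun y hxy hFy => hVU (h y hxy hFy)⟩
  clear hVU hU
  induction hV with
  | basic s hs =>
    obtain ⟨_, ⟨t, rfl | rfl⟩, rfl⟩ := hs
    · exact ⟨∅, finite_empty, empty_disjoint _, fun y hxy _ => hxy hxV⟩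
    · exact ⟨{t}, finite_singleton t, disjoint_singleton_left.2 hxV,
        fun y _ hy => disjoint_singleton_left.1 hy⟩
  | univ => exact ⟨∅, finite_empty, empty_disjoint _, fun y _ _ => trivial⟩
  | inter s t _ _ ihs iht =>
    obtain ⟨F, hF, hFx, hFs⟩ := ihs hxV.1
    obtain ⟨G, hG, hGx, hGt⟩ := iht hxV.2
    refine ⟨F ∪ G, hF.union hG, disjoint_union_left.2 ⟨hFx, hGx⟩, fun y hxy hy => ?_⟩
    rw [disjoint_union_left] at hy
    exact ⟨hFs y hxy hy.1, hGt y hxy hy.2⟩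
  | sUnion S _ ih =>
    obtain ⟨s, hs, hxs⟩ := hxV
    obtain ⟨F, hF, hFx, hFs⟩ := ih s hs hxs
    exact ⟨F, hF, hFx, fun y hxy hy => ⟨s, hs, hFs y hxy hy⟩⟩

theorem IsPath.sUnion {T : Type u} [PartialOrder T] {c : Set (Set T)}
    (hc : IsChain (· ⊆ ·) c) (h : ∀ x ∈ c, IsPath x) : IsPath (⋃₀ c) := by
  refine ⟨?_, ?_⟩
  · rintro a ⟨x, hx, ha⟩ b ⟨y, hy, hb⟩ hab
    rcases hc.total hx hy with hxy | hyx
    · exact (h y hy).1 (hxy ha) hb hab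
    · exact (h x hx).1 ha (hyx hb) hab
  · rintro s t hst ⟨x, hx, ht⟩
    exact ⟨x, hx, (h x hx).2 hst ht⟩

theorem IsRay.sUnion {T : Type u} [PartialOrder T] {c : Set (Set T)}
    (hc : IsChain (· ⊆ ·) c) (h : ∀ x ∈ c, IsRay x) : IsRay (⋃₀ c) := by
  refine ⟨IsPath.sUnion hc fun x hx => (h x hx).1, ?_⟩
  rintro t ⟨x, hx, ht⟩
  obtain ⟨s, hs, hts⟩ := (h x hx).2 t ht
  exact ⟨s, ⟨x, hx, hs⟩, hts⟩

theorem IsPath.exists_isBranch_superset {T : Type u} [PartialOrder T] {x : Set T}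
    (hx : IsPath x) : ∃ y, x ⊆ y ∧ IsBranch y := by
  obtain ⟨y, hxy, hy⟩ := zorn_subset_nonempty {y : Set T | IsPath y}
    (fun c hc hchain _ => ⟨⋃₀ c, IsPath.sUnion hchain hc, fun _ => subset_sUnion_of_mem⟩) x hx
  exact ⟨y, hxy, hy.prop, fun z hz hyz => (hy.le_of_ge hz hyz).antisymm hyz⟩

theorem IsRay.exists_maximal_superset {T : Type u} [PartialOrder T] {x : Set T}
    (hx : IsRay x) : ∃ y, x ⊆ y ∧ Maximal IsRay y :=
  zorn_subset_nonempty {y : Set T | IsRay y}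
    (fun c hc hchain _ => ⟨⋃₀ c, IsRay.sUnion hchain hc, fun _ => subset_sUnion_of_mem⟩) x hx

theorem IsTopOf.notMem {T : Type u} [PartialOrder T] {s : T} {x : Set T}
    (hs : IsTopOf s x) : s ∉ x := by
  rw [← hs]
  exact lt_irrefl s

/-- A path through a top of `x` contains `x`. -/
theorem IsTopOf.subset_of_mem {T : Type u} [PartialOrder T] {s : T} {x y : Set T}
    (hs : IsTopOf s x) (hy : IsPath y) (hsy : s ∈ y) : x ⊆ y := by
  rw [← hs]
  exact fun t ht => hy.2 (le_of_lt ht) hsy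

theorem IsTopOf.eq_of_le {T : Type u} [PartialOrder T] {s t : T} {x : Set T}
    (hs : IsTopOf s x) (ht : IsTopOf t x) (hst : s ≤ t) : s = t := by
  by_contra hne
  refine hs.notMem ?_
  rw [← ht]
  exact lt_of_le_of_ne hst hne

/-- A node outside a path `x` either lies above a top of `x`, or is excluded by some node
of `x`. -/
theorem IsOrderTree.exists_isTopOf_or_disjoint {T : Type u} [PartialOrder T]
    (hT : IsOrderTree T) {x : Set T} (hx : IsPath x) {s : T} (hs : s ∉ x) :
    (∃ t ≤ s, IsTopOf t x) ∨ ∃ t ∈ x, ∀ y, IsPath y → t ∈ y → s ∉ y := by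
  obtain ⟨m, ⟨hms, hmx⟩, hmin⟩ :=
    ((hT.2 s).2.mono (sdiff_subset : Iic s \ x ⊆ Iic s)).exists_minimal ⟨s, le_rfl, hs⟩
  have hsub : Iio m ⊆ x := by
    intro t ht
    by_contra htx
    exact not_lt_of_ge (hmin ⟨(le_of_lt ht).trans hms, htx⟩ (le_of_lt ht)) ht
  by_cases htop : IsTopOf m x
  · exact Or.inl ⟨m, hms, htop⟩
  · obtain ⟨t, htx, htm⟩ : ∃ t ∈ x, ¬ t < m := by
      by_contra! h
      exact htop (hsub.antisymm h)
    refine Or.inr ⟨t, htx, fun y hy hty hsy => ?_⟩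
    rcases hy.1.total hty (hy.2 hms hsy) with h | h
    · rcases h.lt_or_eq with h | rfl
      · exact htm h
      · exact hmx htx
    · exact hmx (hx.2 h htx)

open Filter in
/-- A countable ray with only countably many tops lying on rays is a point of first
countability. -/
theorem RaySpace.isCountablyGenerated_nhds {T : Type u} [PartialOrder T]
    (hT : IsOrderTree T) (x : RaySpace T) (hx : x.1.Countable)
    (hS : {s : T | IsTopOf s x.1 ∧ ∃ y, IsRay y ∧ s ∈ y}.Countable) :
    (𝓝 x).IsCountablyGenerated := by
  have : Countable x.1 := hx
  have : Countable {s : T | IsTopOf s x.1 ∧ ∃ y, IsRay y ∧ s ∈ y} := hS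
  have key : 𝓝 x = (⨅ t : x.1, 𝓟 (raySet t.1)) ⊓
      ⨅ s : {s : T | IsTopOf s x.1 ∧ ∃ y, IsRay y ∧ s ∈ y}, 𝓟 (raySet s.1)ᶜ := by
    rw [RaySpace.nhds_eq]
    refine le_antisymm (inf_le_inf_left _ (le_iInf fun s => ?_))
      (le_inf inf_le_left (le_iInf fun s => ?_))
    · exact iInf_le _ (⟨s.1, s.2.1.notMem⟩ : (x.1ᶜ : Set T))
    · rcases hT.exists_isTopOf_or_disjoint x.2.1 s.2 with ⟨t, hts, ht⟩ | ⟨t, ht, h⟩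
      · by_cases hray : ∃ y, IsRay y ∧ t ∈ y
        · refine inf_le_right.trans ((iInf_le _ ⟨t, ht, hray⟩).trans ?_)
          exact principal_mono.2 fun y hty hsy => hty (y.2.1.2 hts hsy)
        · rw [le_principal_iff]
          exact univ_mem' fun y hsy => hray ⟨y.1, y.2, y.2.1.2 hts hsy⟩
      · refine inf_le_left.trans ((iInf_le _ ⟨t, ht⟩).trans ?_)
        exact principal_mono.2 fun y hty hsy => h y.1 y.2.1 hty hsy
  rw [key]
  infer_instance

/-- If every branch of the order tree `T` is countable, then the set of
points at which `R(T)` is first countable is dense in `R(T)`. -/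
theorem stmt10 {T : Type u} [PartialOrder T] (hT : IsOrderTree T)
    (hcount : ∀ x : Set T, IsBranch x → x.Countable) :
    Dense {x : RaySpace T | (nhds x).IsCountablyGenerated} := by
  have hctbl : ∀ x : RaySpace T, x.1.Countable := fun x =>
    let ⟨y, hxy, hy⟩ := x.2.1.exists_isBranch_superset
    (hcount y hy).mono hxy
  intro x
  rw [mem_closure_iff_nhds]
  intro U hU
  by_cases hS : {s : T | IsTopOf s x.1 ∧ ∃ y, IsRay y ∧ s ∈ y}.Finite
  · exact ⟨x, mem_of_mem_nhds hU,
      RaySpace.isCountablyGenerated_nhds hT x (hctbl x) hS.countable⟩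
  obtain ⟨F, hF, hFx, hFU⟩ := RaySpace.exists_finite_of_mem_nhds hU
  obtain ⟨s, ⟨hs, z, hz, hsz⟩, hsF⟩ :
      ∃ s ∈ {s : T | IsTopOf s x.1 ∧ ∃ y, IsRay y ∧ s ∈ y}, ∀ f ∈ F, ¬ s ≤ f := by
    by_contra! h
    refine hS ((hF.biUnion (t := fun f => {s | IsTopOf s x.1 ∧ s ≤ f}) fun f _ => ?_).subset
      fun s hs => ?_)
    · refine Set.Subsingleton.finite fun a ha b hb => ?_
      rcases (hT.2 f).1.total ha.2 hb.2 with hab | hba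
      · exact ha.1.eq_of_le hb.1 hab
      · exact (hb.1.eq_of_le ha.1 hba).symm
    · obtain ⟨f, hf, hsf⟩ := h s hs
      exact mem_biUnion hf ⟨hs.1, hsf⟩
  obtain ⟨y, hzy, hy⟩ := hz.exists_maximal_superset
  have hsy : s ∈ y := hzy hsz
  refine ⟨⟨y, hy.prop⟩, hFU ⟨y, hy.prop⟩ (hs.subset_of_mem hy.prop.1 hsy) ?_,
    RaySpace.isCountablyGenerated_nhds hT ⟨y, hy.prop⟩ (hctbl ⟨y, hy.prop⟩) ?_⟩
  · refine disjoint_left.2 fun f hf hfy => ?_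
    rcases (hy.prop.1.1.total hsy hfy : s ≤ f ∨ f ≤ s) with h | h
    · exact hsF f hf h
    · refine disjoint_left.1 hFx hf ?_
      rw [← hs]
      exact lt_of_le_of_ne h fun hfs => hsF f hf hfs.ge
  · convert countable_empty
    refine eq_empty_of_forall_notMem fun t ⟨ht, w, hw, htw⟩ => ?_
    have hty : t ∈ y := hy.le_of_ge hw (ht.subset_of_mem hw.1 htw) htw
    exact ht.notMem hty
end
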